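/- There exists a constant c > 0 depending only on d such that the following holds. Let v₀, v₁ : ℤ^d → ℂ be sequences with D := Σ_{n∈ℤ^d} (|v₀(n)| + ⟨n⟩^{−1}|v₁(n)|) finite and positive, and set T = c/D. Then there exists a solution u of the cubic NLW on [−T, T] with data (v₀, v₁) in the FL¹ Duhamel sense. Moreover, the solution is unconditionally unique: for any T' > 0, any two solutions of the cubic NLW on [−T', T'] with the same data (v₀, v₁) in the FL¹ Duhamel sense coincide on [−T', T']. -/

import Mathlib

open scoped BigOperators

noncomputable section

/-- Japanese bracket `⟨n⟩ = √(1+|n|²)` for `n ∈ ℤ^d`. -/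
def jap {d : ℕ} (n : Fin d → ℤ) : ℝ := Real.sqrt (1 + ∑ i, ((n i : ℝ)) ^ 2)

/-- Discrete convolution on `ℤ^d`. -/
def dconv {d : ℕ} (f g : (Fin d → ℤ) → ℂ) : (Fin d → ℤ) → ℂ :=
  fun n => ∑' m, f m * g (n - m)

/-- Triple (cubic) convolution. -/
def dcube {d : ℕ} (f : (Fin d → ℤ) → ℂ) : (Fin d → ℤ) → ℂ := dconv (dconv f f) f

/-- `u` is a continuous map from `I` into `ℓ¹(ℤ^d)`. -/
def ContL1On {d : ℕ} (I : Set ℝ) (u : ℝ → (Fin d → ℤ) → ℂ) : Prop :=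
  (∀ t ∈ I, Summable fun n => ‖u t n‖) ∧
  ∀ t ∈ I, ∀ ε > (0 : ℝ), ∃ δ > (0 : ℝ), ∀ s ∈ I, |s - t| < δ →
    (∑' n, ‖u s n - u t n‖) < ε

/-- `u` solves the cubic NLW on `I` with data `(v₀, v₁)` in the `FL¹` Duhamel sense. -/
def SolvesNLW {d : ℕ} (I : Set ℝ) (v₀ v₁ : (Fin d → ℤ) → ℂ)
    (u : ℝ → (Fin d → ℤ) → ℂ) : Prop :=
  ContL1On I u ∧
  ∀ t ∈ I, ∀ n : Fin d → ℤ,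
    u t n = (Real.cos (t * jap n) : ℂ) * v₀ n
      + ((Real.sin (t * jap n) / jap n : ℝ) : ℂ) * v₁ n
      - ∫ s in (0 : ℝ)..t,
          ((Real.sin ((t - s) * jap n) / jap n : ℝ) : ℂ) * dcube (u s) n

end

section Abstract

open Set

variable {E : Type*} [NormedAddCommGroup E] [NormedSpace ℝ E]

/-- The cubic map `x ↦ B (B x x) x` attached to a bilinear map. -/
noncomputable def trilinearCube (B : E →L[ℝ] E →L[ℝ] E) (x : E) : E := B (B x x) x

lemma continuous_trilinearCube (B : E →L[ℝ] E →L[ℝ] E) : Continuous (trilinearCube B) := by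
  unfold trilinearCube
  fun_prop

lemma norm_trilinearCube_le {B : E →L[ℝ] E →L[ℝ] E} (hB : ∀ x y, ‖B x y‖ ≤ ‖x‖ * ‖y‖)
    {x : E} {M : ℝ} (hx : ‖x‖ ≤ M) : ‖trilinearCube B x‖ ≤ M ^ 3 := by
  calc ‖trilinearCube B x‖ ≤ ‖B x x‖ * ‖x‖ := hB _ _
    _ ≤ (‖x‖ * ‖x‖) * ‖x‖ := by gcongr; exact hB _ _
    _ = ‖x‖ ^ 3 := by ring
    _ ≤ M ^ 3 := by gcongr

lemma norm_trilinearCube_sub_le {B : E →L[ℝ] E →L[ℝ] E} (hB : ∀ x y, ‖B x y‖ ≤ ‖x‖ * ‖y‖)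
    {x y : E} {M : ℝ} (hx : ‖x‖ ≤ M) (hy : ‖y‖ ≤ M) :
    ‖trilinearCube B x - trilinearCube B y‖ ≤ 3 * M ^ 2 * ‖x - y‖ := by
  have hM : 0 ≤ M := (norm_nonneg x).trans hx
  have key : trilinearCube B x - trilinearCube B y
      = B (B x x) (x - y) + B (B x (x - y)) y + B (B (x - y) y) y := by
    simp only [trilinearCube, map_sub, sub_apply]
    abel
  have hle : ∀ a b c : E, ‖B (B a b) c‖ ≤ ‖a‖ * ‖b‖ * ‖c‖ := fun a b c =>
    (hB _ _).trans (by gcongr; exact hB _ _)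
  rw [key]
  calc _ ≤ ‖B (B x x) (x - y)‖ + ‖B (B x (x - y)) y‖ + ‖B (B (x - y) y) y‖ := norm_add₃_le
    _ ≤ ‖x‖ * ‖x‖ * ‖x - y‖ + ‖x‖ * ‖x - y‖ * ‖y‖ + ‖x - y‖ * ‖y‖ * ‖y‖ := by
        gcongr <;> apply hle
    _ ≤ M * M * ‖x - y‖ + M * ‖x - y‖ * M + ‖x - y‖ * M * M := by gcongr
    _ = 3 * M ^ 2 * ‖x - y‖ := by ring

/-- The Duhamel map `u ↦ S(t) - ∫₀ᵗ K(t - s) (u(s)³) ds`. -/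
noncomputable def duhamelMap (S : ℝ → E) (K : ℝ → E →L[ℝ] E) (B : E →L[ℝ] E →L[ℝ] E)
    (u : ℝ → E) (t : ℝ) : E :=
  S t - ∫ s in (0 : ℝ)..t, K (t - s) (trilinearCube B (u s))

lemma continuous_duhamel_integrand {K : ℝ → E →L[ℝ] E} (hK : Continuous K)
    (B : E →L[ℝ] E →L[ℝ] E) {u : ℝ → E} (hu : Continuous u) :
    Continuous fun p : ℝ × ℝ => K (p.1 - p.2) (trilinearCube B (u p.2)) := by
  have := continuous_trilinearCube B
  fun_prop

lemma continuous_duhamelMap {S : ℝ → E} (hS : Continuous S) {K : ℝ → E →L[ℝ] E}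
    (hK : Continuous K) (B : E →L[ℝ] E →L[ℝ] E) {u : ℝ → E} (hu : Continuous u) :
    Continuous (duhamelMap S K B u) :=
  hS.sub (intervalIntegral.continuous_parametric_intervalIntegral_of_continuous
    (continuous_duhamel_integrand hK B hu) continuous_id)

lemma abs_le_of_mem_uIoc_zero {s t : ℝ} (h : s ∈ uIoc 0 t) : |s| ≤ |t| ∧ |t - s| ≤ |t| := by
  rcases mem_uIoc.1 h with ⟨h1, h2⟩ | ⟨h1, h2⟩
  · rw [abs_of_pos h1, abs_of_pos (h1.trans_le h2), abs_of_nonneg (by linarith)]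
    constructor <;> linarith
  · rw [abs_of_nonpos h2, abs_of_neg (h1.trans_le h2), abs_of_neg (by linarith)]
    constructor <;> linarith

lemma norm_duhamelMap_le {S : ℝ → E} {K : ℝ → E →L[ℝ] E} (hK : ∀ t x, ‖K t x‖ ≤ |t| * ‖x‖)
    {B : E →L[ℝ] E →L[ℝ] E} (hB : ∀ x y, ‖B x y‖ ≤ ‖x‖ * ‖y‖) {u : ℝ → E} {M : ℝ}
    (hu : ∀ s, ‖u s‖ ≤ M) (t : ℝ) :
    ‖duhamelMap S K B u t‖ ≤ ‖S t‖ + t ^ 2 * M ^ 3 := by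
  refine (norm_sub_le _ _).trans (add_le_add le_rfl ?_)
  have : ∀ s ∈ uIoc 0 t, ‖K (t - s) (trilinearCube B (u s))‖ ≤ |t| * M ^ 3 := fun s hs =>
    (hK _ _).trans (mul_le_mul (abs_le_of_mem_uIoc_zero hs).2 (norm_trilinearCube_le hB (hu s))
      (norm_nonneg _) (abs_nonneg _))
  refine (intervalIntegral.norm_integral_le_of_norm_le_const this).trans_eq ?_
  rw [sub_zero, ← sq_abs t]
  ring

lemma norm_duhamelMap_sub_le {S : ℝ → E} {K : ℝ → E →L[ℝ] E} (hKc : Continuous K)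
    (hK : ∀ t x, ‖K t x‖ ≤ |t| * ‖x‖) {B : E →L[ℝ] E →L[ℝ] E}
    (hB : ∀ x y, ‖B x y‖ ≤ ‖x‖ * ‖y‖) {u v : ℝ → E} (huc : Continuous u) (hvc : Continuous v)
    {M : ℝ} (hu : ∀ s, ‖u s‖ ≤ M) (hv : ∀ s, ‖v s‖ ≤ M) (t : ℝ) :
    ‖duhamelMap S K B u t - duhamelMap S K B v t‖
      ≤ |t| * (3 * M ^ 2) * |∫ s in (0 : ℝ)..t, ‖u s - v s‖| := by
  have hint : ∀ {w : ℝ → E}, Continuous w → IntervalIntegrable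
      (fun s => K (t - s) (trilinearCube B (w s))) MeasureTheory.volume 0 t := fun hw =>
    ((continuous_duhamel_integrand hKc B hw).comp
      (Continuous.prodMk_right t)).intervalIntegrable _ _
  have : duhamelMap S K B u t - duhamelMap S K B v t
      = -∫ s in (0 : ℝ)..t, K (t - s) (trilinearCube B (u s) - trilinearCube B (v s)) := by
    simp only [map_sub]
    rw [intervalIntegral.integral_sub (hint huc) (hint hvc)]
    simp only [duhamelMap]
    abel
  rw [this, norm_neg]
  have hmul : |t| * (3 * M ^ 2) * |∫ s in (0 : ℝ)..t, ‖u s - v s‖|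
      = |∫ s in (0 : ℝ)..t, |t| * (3 * M ^ 2) * ‖u s - v s‖| := by
    rw [intervalIntegral.integral_const_mul, abs_mul, abs_of_nonneg (a := |t| * _) (by positivity)]
  rw [hmul]
  refine intervalIntegral.norm_integral_le_abs_of_norm_le ?_ ?_
  · filter_upwards [MeasureTheory.ae_restrict_mem measurableSet_uIoc] with s hs
    calc _ ≤ |t - s| * ‖trilinearCube B (u s) - trilinearCube B (v s)‖ := hK _ _
      _ ≤ |t| * (3 * M ^ 2 * ‖u s - v s‖) := by
          gcongr ?_ * ?_
          · exact (abs_le_of_mem_uIoc_zero hs).2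
          · exact norm_trilinearCube_sub_le hB (hu s) (hv s)
      _ = _ := by ring
  · exact Continuous.intervalIntegrable (by fun_prop) _ _

lemma eq_zero_of_le_integral {w : ℝ → ℝ} (hw : Continuous w) (hw0 : ∀ t, 0 ≤ w t) {L T : ℝ}
    (h : ∀ t ∈ Icc 0 T, w t ≤ L * |∫ s in (0 : ℝ)..t, w s|) :
    ∀ t ∈ Icc 0 T, w t = 0 := by
  intro t ht
  have hF := eq_zero_of_abs_deriv_le_mul_abs_self_of_eq_zero_right
    (f := fun t => ∫ s in (0 : ℝ)..t, w s) (f' := w) (K := L) (a := 0) (b := T)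
    (intervalIntegral.continuous_primitive (fun _ _ => hw.intervalIntegrable _ _) 0).continuousOn
    (fun x _ => (hw.integral_hasStrictDerivAt 0 x).hasDerivAt.hasDerivWithinAt)
    intervalIntegral.integral_same
    (fun x hx => by
      rw [Real.norm_of_nonneg (hw0 x)]; exact h x (Ico_subset_Icc_self hx)) t ht
  have := h t ht
  rw [hF, abs_zero, mul_zero] at this
  exact this.antisymm (hw0 t)

lemma eq_zero_of_le_abs_integral {w : ℝ → ℝ} (hw : Continuous w) (hw0 : ∀ t, 0 ≤ w t) {L T : ℝ}
    (h : ∀ t ∈ Icc (-T) T, w t ≤ L * |∫ s in (0 : ℝ)..t, w s|) :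
    ∀ t ∈ Icc (-T) T, w t = 0 := by
  intro t ht
  rcases le_total 0 t with h0 | h0
  · exact eq_zero_of_le_integral hw hw0
      (fun s hs => h s ⟨by linarith [hs.1, hs.2], hs.2⟩) t ⟨h0, ht.2⟩
  · have := eq_zero_of_le_integral (w := fun s => w (-s)) (L := L) (T := T) (by fun_prop)
      (fun s => hw0 _) (fun s hs => by
        rw [intervalIntegral.integral_comp_neg, neg_zero, intervalIntegral.integral_symm, abs_neg]
        exact h (-s) ⟨by linarith [hs.2], by linarith [hs.1, hs.2]⟩) (-t)
        ⟨by linarith, by linarith [ht.1]⟩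
    simpa using this

lemma duhamelMap_congr {S : ℝ → E} {K : ℝ → E →L[ℝ] E} {B : E →L[ℝ] E →L[ℝ] E} {u v : ℝ → E}
    {T : ℝ} (h : ∀ s ∈ Icc (-T) T, u s = v s) {t : ℝ} (ht : t ∈ Icc (-T) T) :
    duhamelMap S K B u t = duhamelMap S K B v t := by
  unfold duhamelMap
  congr 1
  refine intervalIntegral.integral_congr_ae (Filter.Eventually.of_forall fun s hs => ?_)
  have := (abs_le_of_mem_uIoc_zero hs).1.trans (abs_le.2 ht)
  simp only [h s (abs_le.1 this)]

lemma duhamel_unique {S : ℝ → E} {K : ℝ → E →L[ℝ] E} (hKc : Continuous K)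
    (hK : ∀ t x, ‖K t x‖ ≤ |t| * ‖x‖) {B : E →L[ℝ] E →L[ℝ] E}
    (hB : ∀ x y, ‖B x y‖ ≤ ‖x‖ * ‖y‖) {u v : ℝ → E} {T : ℝ} (hT : 0 < T)
    (huc : ContinuousOn u (Icc (-T) T)) (hvc : ContinuousOn v (Icc (-T) T))
    (hu : ∀ t ∈ Icc (-T) T, u t = duhamelMap S K B u t)
    (hv : ∀ t ∈ Icc (-T) T, v t = duhamelMap S K B v t) :
    ∀ t ∈ Icc (-T) T, u t = v t := by
  have hTT : -T ≤ T := by linarith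
  obtain ⟨M₁, hM₁⟩ := isCompact_Icc.exists_bound_of_continuousOn huc
  obtain ⟨M₂, hM₂⟩ := isCompact_Icc.exists_bound_of_continuousOn hvc
  set u' : ℝ → E := IccExtend hTT (domRestrict _ u) with hu'
  set v' : ℝ → E := IccExtend hTT (domRestrict _ v) with hv'
  have eu : ∀ t ∈ Icc (-T) T, u' t = u t := fun t ht => IccExtend_of_mem _ _ ht
  have ev : ∀ t ∈ Icc (-T) T, v' t = v t := fun t ht => IccExtend_of_mem _ _ ht
  have cu : Continuous u' := huc.domRestrict.Icc_extend'
  have cv : Continuous v' := hvc.domRestrict.Icc_extend'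
  have key := eq_zero_of_le_abs_integral (w := fun t => ‖u' t - v' t‖)
    (L := T * (3 * max M₁ M₂ ^ 2)) (T := T) (by fun_prop) (fun _ => norm_nonneg _) ?_
  · intro t ht
    have := key t ht
    rwa [norm_eq_zero, sub_eq_zero, eu t ht, ev t ht] at this
  · intro t ht
    have e : u' t - v' t = duhamelMap S K B u' t - duhamelMap S K B v' t := by
      rw [duhamelMap_congr eu ht, duhamelMap_congr ev ht, ← hu t ht, ← hv t ht, eu t ht, ev t ht]
    simp only [e]
    refine (norm_duhamelMap_sub_le hKc hK hB cu cv
      (fun s => (hM₁ _ (projIcc (-T) T hTT s).2).trans (le_max_left M₁ M₂))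
      (fun s => (hM₂ _ (projIcc (-T) T hTT s).2).trans (le_max_right M₁ M₂)) t).trans ?_
    gcongr
    exact abs_le.2 ht

lemma duhamel_exists [CompleteSpace E] {S : ℝ → E} (hS : Continuous S) {K : ℝ → E →L[ℝ] E}
    (hKc : Continuous K) (hK : ∀ t x, ‖K t x‖ ≤ |t| * ‖x‖) {B : E →L[ℝ] E →L[ℝ] E}
    (hB : ∀ x y, ‖B x y‖ ≤ ‖x‖ * ‖y‖) {D : ℝ} (hD : 0 < D) (hSD : ∀ t, ‖S t‖ ≤ D) :
    ∃ u : ℝ → E, Continuous u ∧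
      ∀ t ∈ Icc (-(1 / 4 / D)) (1 / 4 / D), u t = duhamelMap S K B u t := by
  set T : ℝ := 1 / 4 / D with hTdef
  have hT : 0 < T := by positivity
  have hTD : T * D = 1 / 4 := by rw [hTdef]; field_simp
  have hTT : -T ≤ T := by linarith
  let ext : C(Icc (-T) T, E) → ℝ → E := fun u => IccExtend hTT u
  have hext : ∀ u, Continuous (ext u) := fun u => u.continuous.Icc_extend'
  let Φ : C(Icc (-T) T, E) → C(Icc (-T) T, E) := fun u =>
    ⟨fun t => duhamelMap S K B (ext u) t,
      (continuous_duhamelMap hS hKc B (hext u)).comp continuous_subtype_val⟩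
  let s : Set C(Icc (-T) T, E) := Metric.closedBall 0 (2 * D)
  have hbd : ∀ u ∈ s, ∀ t, ‖ext u t‖ ≤ 2 * D := fun u hu t =>
    (u.norm_coe_le_norm _).trans (mem_closedBall_zero_iff.1 hu)
  have ht2 : ∀ t ∈ Icc (-T) T, t ^ 2 ≤ T ^ 2 := fun t ht => sq_le_sq' ht.1 ht.2
  have hmaps : MapsTo Φ s s := fun u hu => by
    refine mem_closedBall_zero_iff.2 ((ContinuousMap.norm_le _ (by positivity)).2 fun t => ?_)
    calc _ ≤ ‖S t‖ + (t : ℝ) ^ 2 * (2 * D) ^ 3 := norm_duhamelMap_le hK hB (hbd u hu) t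
      _ ≤ D + T ^ 2 * (2 * D) ^ 3 := by
          gcongr ?_ + ?_ * _
          · exact hSD t
          · exact ht2 t t.2
      _ = D + 8 * (T * D) ^ 2 * D := by ring
      _ ≤ 2 * D := by rw [hTD]; linarith
  have hcontr : ContractingWith (3 / 4) (hmaps.restrict Φ s s) := by
    refine ⟨by rw [← NNReal.coe_lt_coe]; norm_num, LipschitzWith.of_dist_le_mul fun u v => ?_⟩
    rw [Subtype.dist_eq, Subtype.dist_eq]
    refine (ContinuousMap.dist_le (by positivity)).2 fun t => ?_
    rw [dist_eq_norm]
    have hI : |∫ s in (0 : ℝ)..t, ‖ext u s - ext v s‖| ≤ dist u.1 v.1 * |(t : ℝ)| := by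
      have := intervalIntegral.norm_integral_le_of_norm_le_const (a := 0) (b := (t : ℝ))
        (f := fun s => ‖ext u s - ext v s‖) (C := dist u.1 v.1) fun s _ => by
          rw [norm_norm, ← dist_eq_norm]
          exact ContinuousMap.dist_apply_le_dist _
      simpa using this
    calc _ ≤ |(t : ℝ)| * (3 * (2 * D) ^ 2) * |∫ s in (0 : ℝ)..t, ‖ext u s - ext v s‖| :=
          norm_duhamelMap_sub_le hKc hK hB (hext u) (hext v) (hbd u u.2) (hbd v v.2) t
      _ ≤ |(t : ℝ)| * (3 * (2 * D) ^ 2) * (dist u.1 v.1 * |(t : ℝ)|) := by gcongr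
      _ = (t : ℝ) ^ 2 * (12 * D ^ 2) * dist u.1 v.1 := by rw [← sq_abs (t : ℝ)]; ring
      _ ≤ T ^ 2 * (12 * D ^ 2) * dist u.1 v.1 := by gcongr ?_ * _ * _; exact ht2 t t.2
      _ = 12 * (T * D) ^ 2 * dist u.1 v.1 := by ring
      _ = _ := by rw [hTD]; norm_num
  obtain ⟨u, -, hu, -⟩ := hcontr.exists_fixedPoint' Metric.isClosed_closedBall.isComplete hmaps
    (Metric.mem_closedBall_self (by positivity)) (edist_ne_top _ _)
  refine ⟨ext u, hext u, fun t ht => ?_⟩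
  calc ext u t = u ⟨t, ht⟩ := IccExtend_of_mem _ _ ht
    _ = Φ u ⟨t, ht⟩ := by rw [hu.eq]
    _ = _ := rfl

end Abstract

noncomputable section WienerAlgebra

open Set

variable {d : ℕ}

/-- The Banach space `ℓ¹(ℤ^d)`. -/
abbrev EllOne (d : ℕ) : Type := lp (fun _ : Fin d → ℤ => ℂ) 1

namespace EllOne

lemma summable_norm (f : EllOne d) : Summable fun n => ‖f n‖ := by
  simpa using (lp.memℓp f).summable (by simp)

lemma norm_eq_tsum (f : EllOne d) : ‖f‖ = ∑' n, ‖f n‖ := by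
  simpa using lp.norm_eq_tsum_rpow (p := 1) (by simp) f

/-- The element of `ℓ¹` with given absolutely summable coefficients. -/
def mk (f : (Fin d → ℤ) → ℂ) (hf : Summable fun n => ‖f n‖) : EllOne d :=
  ⟨f, memℓp_gen (by simpa using hf)⟩

@[simp] lemma mk_apply (f : (Fin d → ℤ) → ℂ) (hf : Summable fun n => ‖f n‖) (n : Fin d → ℤ) :
    mk f hf n = f n := rfl

lemma norm_le_tsum {f : EllOne d} {b : (Fin d → ℤ) → ℝ} (hb : Summable b)
    (h : ∀ n, ‖f n‖ ≤ b n) : ‖f‖ ≤ ∑' n, b n := by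
  rw [norm_eq_tsum]
  exact f.summable_norm.tsum_le_tsum h hb

lemma norm_le_mul_norm {f g : EllOne d} {C : ℝ} (h : ∀ n, ‖f n‖ ≤ C * ‖g n‖) :
    ‖f‖ ≤ C * ‖g‖ := by
  rw [norm_eq_tsum g, ← tsum_mul_left]
  exact norm_le_tsum (g.summable_norm.mul_left C) h

lemma continuous_of_dominated {X : Type*} [TopologicalSpace X] {F : X → EllOne d}
    {b : (Fin d → ℤ) → ℝ} (hb : Summable b) (hF : ∀ x n, ‖F x n‖ ≤ b n)
    (hc : ∀ n, Continuous fun x => F x n) : Continuous F := by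
  refine continuous_iff_continuousAt.2 fun x₀ => tendsto_iff_norm_sub_tendsto_zero.2 ?_
  have : Continuous fun x => ∑' n, ‖F x n - F x₀ n‖ :=
    continuous_tsum (u := fun n => b n + b n) (fun n => by have := hc n; fun_prop) (hb.add hb)
      fun n x => by
        rw [norm_norm]
        exact (norm_sub_le _ _).trans (add_le_add (hF _ _) (hF _ _))
  simpa [norm_eq_tsum] using this.tendsto x₀

end EllOne

lemma summable_norm_mul_sub (f g : EllOne d) :
    Summable fun p : (Fin d → ℤ) × (Fin d → ℤ) => ‖f p.2‖ * ‖g (p.1 - p.2)‖ := by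
  have h := f.summable_norm.mul_of_nonneg g.summable_norm (fun _ => norm_nonneg _)
    (fun _ => norm_nonneg _)
  let e : (Fin d → ℤ) × (Fin d → ℤ) ≃ (Fin d → ℤ) × (Fin d → ℤ) :=
    { toFun := fun p => (p.2, p.1 - p.2)
      invFun := fun q => (q.1 + q.2, q.1)
      left_inv := fun p => by simp
      right_inv := fun q => by simp }
  exact e.summable_iff.2 h

lemma tsum_tsum_norm_mul_sub (f g : EllOne d) :
    ∑' n, ∑' m, ‖f m‖ * ‖g (n - m)‖ = ‖f‖ * ‖g‖ := by
  have hs := summable_norm_mul_sub f g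
  rw [← Summable.tsum_comm (f := fun n m => ‖f m‖ * ‖g (n - m)‖) hs]
  simp_rw [tsum_mul_left]
  have : ∀ m : Fin d → ℤ, ∑' n, ‖g (n - m)‖ = ‖g‖ := fun m => by
    rw [g.norm_eq_tsum]
    exact (Equiv.subRight m).tsum_eq fun n => ‖g n‖
  simp_rw [this, tsum_mul_right, f.norm_eq_tsum]

lemma summable_mul_sub (f g : EllOne d) (n : Fin d → ℤ) :
    Summable fun m => f m * g (n - m) :=
  Summable.of_norm (by simpa using (summable_norm_mul_sub f g).prod_factor n)

lemma norm_dconv_apply_le (f g : EllOne d) (n : Fin d → ℤ) :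
    ‖dconv f g n‖ ≤ ∑' m, ‖f m‖ * ‖g (n - m)‖ := by
  simpa [dconv] using norm_tsum_le_tsum_norm (summable_mul_sub f g n).norm

lemma summable_norm_dconv (f g : EllOne d) : Summable fun n => ‖dconv f g n‖ :=
  .of_nonneg_of_le (fun _ => norm_nonneg _) (norm_dconv_apply_le f g)
    (summable_norm_mul_sub f g).prod

/-- Convolution as a continuous bilinear map on `ℓ¹`. -/
def convCLM (d : ℕ) : EllOne d →L[ℝ] EllOne d →L[ℝ] EllOne d :=
  LinearMap.mkContinuous₂
    (LinearMap.mk₂ ℝ (fun f g => EllOne.mk (dconv f g) (summable_norm_dconv f g))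
      (fun f f' g => by
        ext n
        simp only [EllOne.mk_apply, dconv, lp.coeFn_add, Pi.add_apply, add_mul]
        exact (summable_mul_sub f g n).tsum_add (summable_mul_sub f' g n))
      (fun c f g => by
        ext n
        simp only [EllOne.mk_apply, dconv, lp.coeFn_smul, Pi.smul_apply, smul_mul_assoc]
        exact (summable_mul_sub f g n).tsum_const_smul c)
      (fun f g g' => by
        ext n
        simp only [EllOne.mk_apply, dconv, lp.coeFn_add, Pi.add_apply, mul_add]
        exact (summable_mul_sub f g n).tsum_add (summable_mul_sub f g' n))
      (fun c f g => by
        ext n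
        simp only [EllOne.mk_apply, dconv, lp.coeFn_smul, Pi.smul_apply, mul_smul_comm]
        exact (summable_mul_sub f g n).tsum_const_smul c))
    1 fun f g => by
      rw [one_mul, ← tsum_tsum_norm_mul_sub]
      exact EllOne.norm_le_tsum (summable_norm_mul_sub f g).prod (norm_dconv_apply_le f g)

lemma norm_convCLM_le (f g : EllOne d) : ‖convCLM d f g‖ ≤ ‖f‖ * ‖g‖ := by
  rw [← tsum_tsum_norm_mul_sub]
  exact EllOne.norm_le_tsum (summable_norm_mul_sub f g).prod (norm_dconv_apply_le f g)

lemma jap_pos (n : Fin d → ℤ) : 0 < jap n :=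
  Real.sqrt_pos.2 (by positivity)

lemma abs_sin_mul_div_sub_le {j : ℝ} (hj : 0 < j) (a b : ℝ) :
    |Real.sin (a * j) / j - Real.sin (b * j) / j| ≤ |a - b| := by
  rw [← sub_div, abs_div, abs_of_pos hj, div_le_iff₀ hj]
  calc |Real.sin (a * j) - Real.sin (b * j)| ≤ |a * j - b * j| := Real.abs_sin_sub_sin_le _ _
    _ = |a - b| * j := by rw [← sub_mul, abs_mul, abs_of_pos hj]

lemma abs_sin_mul_div_le {j : ℝ} (hj : 0 < j) (a : ℝ) : |Real.sin (a * j) / j| ≤ |a| := by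
  simpa using abs_sin_mul_div_sub_le hj a 0

/-- The Fourier multiplier `sin(t⟨n⟩)/⟨n⟩` on `ℓ¹`. -/
def sineCLM (d : ℕ) (t : ℝ) : EllOne d →L[ℝ] EllOne d :=
  LinearMap.mkContinuous
    { toFun := fun f => EllOne.mk (fun n => ((Real.sin (t * jap n) / jap n : ℝ) : ℂ) * f n)
        (.of_nonneg_of_le (fun _ => norm_nonneg _)
          (fun n => by
            rw [norm_mul, Complex.norm_real]
            exact mul_le_mul_of_nonneg_right (abs_sin_mul_div_le (jap_pos n) t) (norm_nonneg _))
          (f.summable_norm.mul_left |t|))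
      map_add' := fun f g => by
        ext n
        simp only [EllOne.mk_apply, lp.coeFn_add, Pi.add_apply, mul_add]
      map_smul' := fun c f => by
        ext n
        simp only [EllOne.mk_apply, lp.coeFn_smul, Pi.smul_apply, mul_smul_comm, RingHom.id_apply] }
    |t| fun f => EllOne.norm_le_mul_norm fun n => by
      simp only [LinearMap.coe_mk, AddHom.coe_mk, EllOne.mk_apply]
      rw [norm_mul, Complex.norm_real]
      exact mul_le_mul_of_nonneg_right (abs_sin_mul_div_le (jap_pos n) t) (norm_nonneg _)

lemma sineCLM_apply (t : ℝ) (f : EllOne d) (n : Fin d → ℤ) :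
    sineCLM d t f n = ((Real.sin (t * jap n) / jap n : ℝ) : ℂ) * f n := rfl

lemma norm_sineCLM_apply_le (t : ℝ) (f : EllOne d) : ‖sineCLM d t f‖ ≤ |t| * ‖f‖ :=
  EllOne.norm_le_mul_norm fun n => by
    rw [sineCLM_apply, norm_mul, Complex.norm_real]
    exact mul_le_mul_of_nonneg_right (abs_sin_mul_div_le (jap_pos n) t) (norm_nonneg _)

lemma continuous_sineCLM : Continuous (sineCLM d) := by
  refine (LipschitzWith.of_dist_le_mul (K := 1) fun a b => ?_).continuous
  rw [dist_eq_norm, Real.dist_eq, NNReal.coe_one, one_mul]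
  refine ContinuousLinearMap.opNorm_le_bound _ (abs_nonneg _) fun f => ?_
  refine EllOne.norm_le_mul_norm fun n => ?_
  rw [sub_apply, lp.coeFn_sub, Pi.sub_apply, sineCLM_apply, sineCLM_apply, ← sub_mul,
    ← Complex.ofReal_sub, norm_mul, Complex.norm_real]
  exact mul_le_mul_of_nonneg_right (abs_sin_mul_div_sub_le (jap_pos n) a b) (norm_nonneg _)

/-- The Fourier coefficients of the free evolution. -/
def freeWave (v₀ v₁ : (Fin d → ℤ) → ℂ) (t : ℝ) (n : Fin d → ℤ) : ℂ :=
  (Real.cos (t * jap n) : ℂ) * v₀ n + ((Real.sin (t * jap n) / jap n : ℝ) : ℂ) * v₁ n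

lemma norm_freeWave_le (v₀ v₁ : (Fin d → ℤ) → ℂ) (t : ℝ) (n : Fin d → ℤ) :
    ‖freeWave v₀ v₁ t n‖ ≤ ‖v₀ n‖ + (jap n)⁻¹ * ‖v₁ n‖ := by
  refine (norm_add_le _ _).trans ?_
  rw [norm_mul, norm_mul, Complex.norm_real, Complex.norm_real, Real.norm_eq_abs, Real.norm_eq_abs,
    abs_div, abs_of_pos (jap_pos n), ← one_div]
  have := (jap_pos n).le
  gcongr
  · exact mul_le_of_le_one_left (norm_nonneg _) (Real.abs_cos_le_one _)
  · exact Real.abs_sin_le_one _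

/-- The free evolution as a curve in `ℓ¹`. -/
def freeWaveL (v₀ v₁ : (Fin d → ℤ) → ℂ)
    (h : Summable fun n => ‖v₀ n‖ + (jap n)⁻¹ * ‖v₁ n‖) (t : ℝ) : EllOne d :=
  EllOne.mk (freeWave v₀ v₁ t)
    (.of_nonneg_of_le (fun _ => norm_nonneg _) (norm_freeWave_le v₀ v₁ t) h)

lemma norm_freeWaveL_le {v₀ v₁ : (Fin d → ℤ) → ℂ}
    (h : Summable fun n => ‖v₀ n‖ + (jap n)⁻¹ * ‖v₁ n‖) (t : ℝ) :
    ‖freeWaveL v₀ v₁ h t‖ ≤ ∑' n, (‖v₀ n‖ + (jap n)⁻¹ * ‖v₁ n‖) :=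
  EllOne.norm_le_tsum h (norm_freeWave_le v₀ v₁ t)

lemma continuous_freeWaveL {v₀ v₁ : (Fin d → ℤ) → ℂ}
    (h : Summable fun n => ‖v₀ n‖ + (jap n)⁻¹ * ‖v₁ n‖) : Continuous (freeWaveL v₀ v₁ h) :=
  EllOne.continuous_of_dominated h (norm_freeWave_le v₀ v₁) fun n => by
    simp only [freeWaveL, EllOne.mk_apply, freeWave]
    fun_prop

lemma duhamelMap_apply {v₀ v₁ : (Fin d → ℤ) → ℂ}
    (h : Summable fun n => ‖v₀ n‖ + (jap n)⁻¹ * ‖v₁ n‖) {u : ℝ → EllOne d} {t : ℝ}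
    (hu : ContinuousOn u (uIcc 0 t)) (n : Fin d → ℤ) :
    duhamelMap (freeWaveL v₀ v₁ h) (sineCLM d) (convCLM d) u t n
      = (Real.cos (t * jap n) : ℂ) * v₀ n + ((Real.sin (t * jap n) / jap n : ℝ) : ℂ) * v₁ n
        - ∫ s in (0 : ℝ)..t,
            ((Real.sin ((t - s) * jap n) / jap n : ℝ) : ℂ) * dcube (u s) n := by
  have hint : IntervalIntegrable (fun s => sineCLM d (t - s) (trilinearCube (convCLM d) (u s)))
      MeasureTheory.volume 0 t := by
    refine ContinuousOn.intervalIntegrable ?_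
    have h1 := (continuous_trilinearCube (convCLM d)).comp_continuousOn hu
    have h2 : Continuous fun s => sineCLM d (t - s) := continuous_sineCLM.comp (by fun_prop)
    exact h2.continuousOn.clm_apply h1
  have := (lp.evalCLM ℝ (fun _ : Fin d → ℤ => ℂ) 1 n).intervalIntegral_comp_comm hint
  rw [duhamelMap, lp.coeFn_sub, Pi.sub_apply]
  exact congrArg (_ - ·) this.symm

lemma contL1On_coe {I : Set ℝ} {u : ℝ → EllOne d} (hu : ContinuousOn u I) :
    ContL1On I fun t => ⇑(u t) := by
  refine ⟨fun t _ => (u t).summable_norm, fun t ht ε hε => ?_⟩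
  obtain ⟨δ, hδ, H⟩ := Metric.continuousOn_iff.1 hu t ht ε hε
  refine ⟨δ, hδ, fun s hs hst => ?_⟩
  have := H s hs hst
  rwa [dist_eq_norm, EllOne.norm_eq_tsum] at this

open Classical in
/-- The `ℓ¹`-valued lift of a family of sequences, zero where not summable. -/
def liftEllOne (u : ℝ → (Fin d → ℤ) → ℂ) (t : ℝ) : EllOne d :=
  if h : Summable fun n => ‖u t n‖ then EllOne.mk (u t) h else 0

lemma liftEllOne_coe {u : ℝ → (Fin d → ℤ) → ℂ} {t : ℝ} (h : Summable fun n => ‖u t n‖) :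
    ⇑(liftEllOne u t) = u t := by
  rw [liftEllOne, dif_pos h]
  rfl

lemma ContL1On.continuousOn_liftEllOne {I : Set ℝ} {u : ℝ → (Fin d → ℤ) → ℂ}
    (hu : ContL1On I u) : ContinuousOn (liftEllOne u) I := by
  refine Metric.continuousOn_iff.2 fun t ht ε hε => ?_
  obtain ⟨δ, hδ, H⟩ := hu.2 t ht ε hε
  refine ⟨δ, hδ, fun s hs hst => ?_⟩
  rw [dist_eq_norm, EllOne.norm_eq_tsum, lp.coeFn_sub, liftEllOne_coe (hu.1 s hs),
    liftEllOne_coe (hu.1 t ht)]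
  exact H s hs hst

lemma uIcc_zero_subset {t T : ℝ} (ht : t ∈ Icc (-T) T) : uIcc 0 t ⊆ Icc (-T) T :=
  uIcc_subset_Icc ⟨by linarith [ht.1, ht.2], by linarith [ht.1, ht.2]⟩ ht

lemma SolvesNLW.liftEllOne_eq {v₀ v₁ : (Fin d → ℤ) → ℂ}
    (h : Summable fun n => ‖v₀ n‖ + (jap n)⁻¹ * ‖v₁ n‖) {T : ℝ} {u : ℝ → (Fin d → ℤ) → ℂ}
    (hu : SolvesNLW (Icc (-T) T) v₀ v₁ u) {t : ℝ} (ht : t ∈ Icc (-T) T) :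
    liftEllOne u t
      = duhamelMap (freeWaveL v₀ v₁ h) (sineCLM d) (convCLM d) (liftEllOne u) t := by
  ext n
  rw [duhamelMap_apply h (hu.1.continuousOn_liftEllOne.mono (uIcc_zero_subset ht)),
    liftEllOne_coe (hu.1.1 t ht), hu.2 t ht n]
  congr 1
  refine intervalIntegral.integral_congr fun s hs => ?_
  simp only [liftEllOne_coe (hu.1.1 s (uIcc_zero_subset ht hs))]

end WienerAlgebra

/-- Local well-posedness of the cubic NLW in the Wiener algebra `FL¹(𝕋^d)`
on a time interval of length `∼ ‖(v₀,v₁)‖_{FL¹ × FL^{-1,1}}^{-1}`,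
together with unconditional uniqueness. -/
theorem nlw_FL1_lwp_and_unconditional_uniqueness (d : ℕ) :
    ∃ c : ℝ, 0 < c ∧
      ∀ v₀ v₁ : (Fin d → ℤ) → ℂ,
        Summable (fun n => ‖v₀ n‖ + (jap n)⁻¹ * ‖v₁ n‖) →
        0 < (∑' n, (‖v₀ n‖ + (jap n)⁻¹ * ‖v₁ n‖)) →
        (∃ u : ℝ → (Fin d → ℤ) → ℂ,
          SolvesNLW
            (Set.Icc (-(c / ∑' n, (‖v₀ n‖ + (jap n)⁻¹ * ‖v₁ n‖)))
              (c / ∑' n, (‖v₀ n‖ + (jap n)⁻¹ * ‖v₁ n‖)))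
            v₀ v₁ u) ∧
        (∀ T' : ℝ, 0 < T' → ∀ u₁ u₂ : ℝ → (Fin d → ℤ) → ℂ,
          SolvesNLW (Set.Icc (-T') T') v₀ v₁ u₁ →
          SolvesNLW (Set.Icc (-T') T') v₀ v₁ u₂ →
          ∀ t ∈ Set.Icc (-T') T', u₁ t = u₂ t) := by
  refine ⟨1 / 4, by norm_num, fun v₀ v₁ h hD => ⟨?_, fun T' hT u₁ u₂ h₁ h₂ t ht => ?_⟩⟩
  · obtain ⟨u, hu, hsol⟩ := duhamel_exists (continuous_freeWaveL h) continuous_sineCLM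
      norm_sineCLM_apply_le norm_convCLM_le hD (norm_freeWaveL_le h)
    refine ⟨fun t => u t, contL1On_coe hu.continuousOn, fun t ht n => ?_⟩
    rw [← duhamelMap_apply h hu.continuousOn, ← hsol t ht]
  · have := duhamel_unique continuous_sineCLM norm_sineCLM_apply_le norm_convCLM_le hT
      h₁.1.continuousOn_liftEllOne h₂.1.continuousOn_liftEllOne
      (fun s hs => h₁.liftEllOne_eq h hs) (fun s hs => h₂.liftEllOne_eq h hs) t ht
    rw [← liftEllOne_coe (h₁.1.1 t ht), this, liftEllOne_coe (h₂.1.1 t ht)]
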